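/- Let T, M ≥ 1, let ε ∈ (0,1], let a_1,…,a_T ≥ 0, and let q, q̃ : {1,…,T}×{1,…,M} → ℝ satisfy q_{t,m} ≥ ε/M, 0 ≤ q̃_{t,m} ≤ q_{t,m}, and ∑_{t=1}^T ∑_{m=1}^M q̃_{t,m} ≤ 1. Then ∑_{t=1}^T ∑_{m=1}^M q̃_{t,m}·a_t/q_{t,m} ≤ M·∑_{τ=1}^{⌈1/ε⌉} a'_τ, where a'_1 ≥ a'_2 ≥ … ≥ a'_T is the nonincreasing rearrangement of (a_1,…,a_T) and a'_τ = 0 for τ > T. -/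

import Mathlib

/-- Bounding a weighted sum with weights in `[0, B]` by shifting the values by a threshold `c`. -/
theorem sum_mul_le_of_threshold {ι : Type*} (s : Finset ι) (w a : ι → ℝ) {B S c : ℝ}
    (hc : 0 ≤ c) (hw0 : ∀ t ∈ s, 0 ≤ w t) (hwB : ∀ t ∈ s, w t ≤ B) (hS : ∑ t ∈ s, w t ≤ S) :
    ∑ t ∈ s, w t * a t ≤ B * ∑ t ∈ s, max (a t - c) 0 + c * S := by
  have hterm : ∀ t ∈ s, w t * a t ≤ B * max (a t - c) 0 + c * w t := fun t ht => by
    have h₁ : w t * (a t - c) ≤ w t * max (a t - c) 0 :=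
      mul_le_mul_of_nonneg_left (le_max_left _ _) (hw0 t ht)
    have h₂ : w t * max (a t - c) 0 ≤ B * max (a t - c) 0 :=
      mul_le_mul_of_nonneg_right (hwB t ht) (le_max_right _ _)
    linarith
  calc ∑ t ∈ s, w t * a t ≤ ∑ t ∈ s, (B * max (a t - c) 0 + c * w t) := Finset.sum_le_sum hterm
    _ = B * ∑ t ∈ s, max (a t - c) 0 + c * ∑ t ∈ s, w t := by
        rw [Finset.sum_add_distrib, Finset.mul_sum, Finset.mul_sum]
    _ ≤ B * ∑ t ∈ s, max (a t - c) 0 + c * S := by gcongr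

/-- For a nonincreasing sequence `b`, the excesses over the threshold `b K` are supported on
the first `K` indices. -/
theorem sum_max_sub_le_of_antitoneOn {b : ℕ → ℝ} (hb : AntitoneOn b (Set.Ici 1)) (T : ℕ) {K : ℕ}
    (hK : 1 ≤ K) :
    ∑ t ∈ Finset.Icc 1 T, max (b t - b K) 0 ≤ ∑ t ∈ Finset.Icc 1 K, b t - b K * K := by
  calc ∑ t ∈ Finset.Icc 1 T, max (b t - b K) 0
      ≤ ∑ t ∈ Finset.Icc 1 (max T K), max (b t - b K) 0 :=
        Finset.sum_le_sum_of_subset_of_nonneg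
          (Finset.Icc_subset_Icc_right (le_max_left _ _)) fun _ _ _ => le_max_right _ _
    _ = ∑ t ∈ Finset.Icc 1 K, max (b t - b K) 0 := by
        symm
        refine Finset.sum_subset (Finset.Icc_subset_Icc_right (le_max_right _ _)) ?_
        intro t ht htK
        simp only [Finset.mem_Icc, not_and, not_le] at ht htK
        exact max_eq_right (sub_nonpos.2 (hb hK ht.1 (htK ht.1).le))
    _ = ∑ t ∈ Finset.Icc 1 K, (b t - b K) := by
        refine Finset.sum_congr rfl fun t ht => ?_
        rw [Finset.mem_Icc] at ht
        exact max_eq_left (sub_nonneg.2 (hb ht.1 hK ht.2))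
    _ = ∑ t ∈ Finset.Icc 1 K, b t - b K * K := by
        simp [Finset.sum_sub_distrib, mul_comm]

/-- The deterministic optimization claim used to bound `E[D_T]` in the proof of
Theorem (thm:21).  The function `a'` is the nonincreasing rearrangement of
`a` on `{1,…,T}` (expressed as a multiset equality), extended by `0` beyond
`T`. -/
theorem stmt_16 (T M : ℕ) (hT : 1 ≤ T) (hM : 1 ≤ M)
    (ε : ℝ) (hε0 : 0 < ε) (hε1 : ε ≤ 1)
    (a : ℕ → ℝ) (ha : ∀ t, 1 ≤ t → t ≤ T → 0 ≤ a t)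
    (q qt : ℕ → Fin M → ℝ)
    (hq : ∀ t, 1 ≤ t → t ≤ T → ∀ m, ε / M ≤ q t m)
    (hqt0 : ∀ t, 1 ≤ t → t ≤ T → ∀ m, 0 ≤ qt t m)
    (hqtq : ∀ t, 1 ≤ t → t ≤ T → ∀ m, qt t m ≤ q t m)
    (hmass : ∑ t ∈ Finset.Icc 1 T, ∑ m, qt t m ≤ 1)
    (a' : ℕ → ℝ)
    (hperm : Multiset.map a' (Finset.Icc 1 T).val = Multiset.map a (Finset.Icc 1 T).val)
    (hmono : ∀ τ τ', 1 ≤ τ → τ ≤ τ' → τ' ≤ T → a' τ' ≤ a' τ)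
    (hzero : ∀ τ, T < τ → a' τ = 0) :
    ∑ t ∈ Finset.Icc 1 T, ∑ m, qt t m * a t / q t m ≤
      M * ∑ τ ∈ Finset.Icc 1 ⌈1 / ε⌉₊, a' τ := by
  have hM0 : (0 : ℝ) < M := by exact_mod_cast hM
  have hδ : 0 < ε / M := div_pos hε0 hM0
  have ha'_nonneg : ∀ τ, 1 ≤ τ → 0 ≤ a' τ := by
    intro τ hτ
    rcases le_or_gt τ T with hτT | hτT
    · have hmem : a' τ ∈ Multiset.map a' (Finset.Icc 1 T).val :=
        Multiset.mem_map_of_mem a' (Finset.mem_Icc.2 ⟨hτ, hτT⟩)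
      rw [hperm, Multiset.mem_map] at hmem
      obtain ⟨t, ht : t ∈ Finset.Icc 1 T, hta⟩ := hmem
      obtain ⟨ht1, htT⟩ := Finset.mem_Icc.1 ht
      exact hta ▸ ha t ht1 htT
    · exact (hzero τ hτT).ge
  have hanti : AntitoneOn a' (Set.Ici 1) := by
    intro τ hτ τ' hτ' hle
    rcases le_or_gt τ' T with hT' | hT'
    · exact hmono τ τ' hτ hle hT'
    · rw [hzero τ' hT']
      exact ha'_nonneg τ hτ
  have hK : 1 ≤ ⌈1 / ε⌉₊ := Nat.one_le_ceil_iff.2 (by positivity)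
  have hratio : ∀ t ∈ Finset.Icc 1 T, ∀ m,
      0 ≤ qt t m / q t m ∧ qt t m / q t m ≤ 1 ∧ ε / M * (qt t m / q t m) ≤ qt t m := by
    intro t ht m
    obtain ⟨h1, h2⟩ := Finset.mem_Icc.1 ht
    have hpos : 0 < q t m := hδ.trans_le (hq t h1 h2 m)
    have h0 : 0 ≤ qt t m / q t m := div_nonneg (hqt0 t h1 h2 m) hpos.le
    refine ⟨h0, (div_le_one hpos).2 (hqtq t h1 h2 m), ?_⟩
    calc ε / M * (qt t m / q t m) ≤ q t m * (qt t m / q t m) :=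
          mul_le_mul_of_nonneg_right (hq t h1 h2 m) h0
      _ = qt t m := mul_div_cancel₀ _ hpos.ne'
  have htotal : ∑ t ∈ Finset.Icc 1 T, ∑ m, qt t m / q t m ≤ M * (⌈1 / ε⌉₊ : ℝ) := by
    have h : ε / M * ∑ t ∈ Finset.Icc 1 T, ∑ m, qt t m / q t m ≤ 1 := by
      simp only [Finset.mul_sum]
      exact (Finset.sum_le_sum fun t ht =>
        Finset.sum_le_sum fun m _ => (hratio t ht m).2.2).trans hmass
    calc ∑ t ∈ Finset.Icc 1 T, ∑ m, qt t m / q t m ≤ 1 / (ε / M) := (le_div_iff₀' hδ).2 h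
      _ = M * (1 / ε) := by field_simp
      _ ≤ M * (⌈1 / ε⌉₊ : ℝ) := by gcongr; exact Nat.le_ceil _
  have hrearr : ∀ f : ℝ → ℝ,
      ∑ t ∈ Finset.Icc 1 T, f (a t) = ∑ t ∈ Finset.Icc 1 T, f (a' t) := by
    intro f
    have h := congrArg (fun s => (Multiset.map f s).sum) hperm
    simpa only [Multiset.map_map, Finset.sum, Function.comp_def] using h.symm
  calc ∑ t ∈ Finset.Icc 1 T, ∑ m, qt t m * a t / q t m
      = ∑ t ∈ Finset.Icc 1 T, (∑ m, qt t m / q t m) * a t := by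
        simp only [Finset.sum_mul, div_mul_eq_mul_div]
    _ ≤ M * ∑ t ∈ Finset.Icc 1 T, max (a t - a' ⌈1 / ε⌉₊) 0
          + a' ⌈1 / ε⌉₊ * (M * (⌈1 / ε⌉₊ : ℝ)) := by
        refine sum_mul_le_of_threshold _ _ _ (ha'_nonneg _ hK)
          (fun t ht => Finset.sum_nonneg fun m _ => (hratio t ht m).1) (fun t ht => ?_) htotal
        simpa using Finset.sum_le_sum fun m (_ : m ∈ Finset.univ) => (hratio t ht m).2.1
    _ ≤ M * (∑ τ ∈ Finset.Icc 1 ⌈1 / ε⌉₊, a' τ - a' ⌈1 / ε⌉₊ * ⌈1 / ε⌉₊)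
          + a' ⌈1 / ε⌉₊ * (M * (⌈1 / ε⌉₊ : ℝ)) := by
        rw [hrearr fun x => max (x - a' ⌈1 / ε⌉₊) 0]
        gcongr
        exact sum_max_sub_le_of_antitoneOn hanti T hK
    _ = M * ∑ τ ∈ Finset.Icc 1 ⌈1 / ε⌉₊, a' τ := by ring
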